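/- Let B be a finite field and F a field extension of B of degree t. Let ℓ, d, k be positive integers with ℓ ≤ k ≤ ℓ + d − 1, let β_1, …, β_ℓ, α_1, …, α_d be ℓ + d pairwise distinct elements of F, and let κ_1, …, κ_ℓ ∈ F be nonzero. Let C = RS({β_1,…,β_ℓ,α_1,…,α_d}, k) and let M ∈ F^{(ℓ+d)×t} be a matrix such that: (C1) every column of M is orthogonal to C; (C2) (∏_{i≠1} κ_i)·M[1,:] = (∏_{i≠2} κ_i)·M[2,:] = ⋯ = (∏_{i≠ℓ} κ_i)·M[ℓ,:], and the t entries of this common row are linearly independent over B. For j ∈ [d] let b_j = dim_B span_B of the t entries of row M[ℓ+j,:]. Then ∑_{j=1}^d |B|^{−b_j} ≤ ( (|F| − 1)(ℓ + d − k − 1) + d ) / |F|. -/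

import Mathlib

open Finset Polynomial

theorem aux_weight {F ι : Type*} [Field F] [Fintype ι] [DecidableEq ι] [DecidableEq F]
    (ω : ι → F) (hω : Function.Injective ω) (k : ℕ) (v : ι → F)
    (h : ∀ f : Polynomial F, f.degree < (k : WithBot ℕ) → ∑ i, v i * f.eval (ω i) = 0)
    (i₀ : ι) (hi₀ : v i₀ ≠ 0) : k + 1 ≤ (univ.filter fun i => v i ≠ 0).card := by
  by_contra hlt
  push Not at hlt
  have hmem : i₀ ∈ univ.filter fun i => v i ≠ 0 := by simp [hi₀]
  set S := univ.filter fun i => v i ≠ 0 with hS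
  have hc : (S.erase i₀).card < k := by
    have h1 := Finset.card_erase_of_mem hmem
    have h2 := Finset.card_pos.mpr ⟨i₀, hmem⟩
    omega
  have h3 := h (∏ i ∈ S.erase i₀, (X - C (ω i))) (by
    rw [Polynomial.degree_prod]
    simp only [Polynomial.degree_X_sub_C, Finset.sum_const, nsmul_eq_mul, mul_one]
    exact_mod_cast hc)
  rw [Finset.sum_eq_single i₀] at h3
  · rw [Polynomial.eval_prod] at h3
    rcases mul_eq_zero.mp h3 with h4 | h4
    · exact hi₀ h4
    · obtain ⟨i, hi, h5⟩ := Finset.prod_eq_zero_iff.mp h4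
      simp only [eval_sub, eval_X, eval_C] at h5
      exact (Finset.ne_of_mem_erase hi) (hω (sub_eq_zero.mp h5)).symm
  · intro i _ hne
    by_cases hv : v i = 0
    · simp [hv]
    · rw [Polynomial.eval_prod, Finset.prod_eq_zero (i := i), mul_zero]
      · simp [hS, hne, hv]
      · simp
  · simp

theorem aux_kernel {B F : Type*} [Field B] [Fintype B] [Field F] [Fintype F] [Algebra B F]
    [DecidableEq F] (t : ℕ) (r : Fin t → F) :
    (Fintype.card B : ℝ) ^ (-(Module.finrank B (Submodule.span B (Set.range r)) : ℤ)) =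
      ((univ.filter fun γ : Fin t → B => ∑ m, γ m • r m = 0).card : ℝ) /
        (Fintype.card B : ℝ) ^ t := by
  classical
  have hr := LinearMap.finrank_range_add_finrank_ker (Fintype.linearCombination B r)
  rw [Fintype.range_linearCombination] at hr
  simp only [Module.finrank_fin_fun] at hr
  have hcard : (univ.filter fun γ : Fin t → B => ∑ m, γ m • r m = 0).card =
      Fintype.card B ^ Module.finrank B (LinearMap.ker (Fintype.linearCombination B r)) := by
    rw [← Module.card_eq_pow_finrank (K := B), Fintype.card_subtype]
    congr 1
    ext γ
    simp [LinearMap.mem_ker, Fintype.linearCombination_apply]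
  have hB : (Fintype.card B : ℝ) ≠ 0 := by
    exact_mod_cast Fintype.card_ne_zero
  rw [hcard, eq_div_iff (pow_ne_zero _ hB)]
  push_cast
  have hp : (Fintype.card B : ℝ) ^ t = (Fintype.card B : ℝ) ^ (_ + _) := congrArg _ hr.symm
  rw [hp, zpow_neg, zpow_natCast, pow_add]
  field_simp

/-- For any `(κ, C)`-evaluation matrix `M` of the Reed–Solomon code on the distinct
points `β_1,…,β_ℓ,α_1,…,α_d` (conditions (C1) and (C2)), the `B`-ranks
`b_j = dim_B span_B {M[ℓ+j, 1], …, M[ℓ+j, t]}` satisfy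
`∑_j |B|^{-b_j} ≤ ((|F| - 1)(ℓ + d - k - 1) + d) / |F|`. -/
theorem evaluation_matrix_rank_constraint {B F : Type*} [Field B] [Fintype B]
    [Field F] [Fintype F] [Algebra B F]
    (t : ℕ) (ht : Module.finrank B F = t)
    (ℓ d k : ℕ) (hℓ : 0 < ℓ) (hd : 0 < d) (hk : 0 < k)
    (hℓk : ℓ ≤ k) (hkℓd : k ≤ ℓ + d - 1)
    (β : Fin ℓ → F) (α : Fin d → F)
    (hinj : Function.Injective (Sum.elim β α))
    (κ : Fin ℓ → F) (hκ : ∀ i, κ i ≠ 0)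
    (M : Fin ℓ ⊕ Fin d → Fin t → F)
    (hC1 : ∀ f : Polynomial F, f.degree < (k : WithBot ℕ) → ∀ m : Fin t,
      ∑ i : Fin ℓ ⊕ Fin d, M i m * f.eval (Sum.elim β α i) = 0)
    (hC2 : ∀ i i' : Fin ℓ, ∀ m : Fin t,
      (∏ i'' ∈ Finset.univ.erase i, κ i'') * M (Sum.inl i) m =
        (∏ i'' ∈ Finset.univ.erase i', κ i'') * M (Sum.inl i') m)
    (hC2' : LinearIndependent B (fun m : Fin t =>
      (∏ i'' ∈ Finset.univ.erase (⟨0, hℓ⟩ : Fin ℓ), κ i'') * M (Sum.inl ⟨0, hℓ⟩) m)) :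
    ∑ j : Fin d,
        (Fintype.card B : ℝ) ^
          (-(Module.finrank B
              (Submodule.span B (Set.range fun m : Fin t => M (Sum.inr j) m)) : ℤ))
      ≤ (((Fintype.card F : ℝ) - 1) * ((ℓ : ℝ) + d - k - 1) + d) /
          (Fintype.card F : ℝ) := by
  classical
  have hcF : Fintype.card F = Fintype.card B ^ t := by
    rw [← ht]; exact Module.card_eq_pow_finrank (K := B)
  have hB : (0 : ℝ) < Fintype.card B := by exact_mod_cast Fintype.card_pos
  have hcF' : (Fintype.card F : ℝ) = (Fintype.card B : ℝ) ^ t := by exact_mod_cast hcF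
  simp_rw [aux_kernel t]
  rw [← Finset.sum_div, hcF']
  refine div_le_div_of_nonneg_right ?_ (by positivity)
  rw [← hcF']
  have key : ∀ γ : Fin t → B, γ ≠ 0 →
      ((univ.filter fun j : Fin d => ∑ m, γ m • M (Sum.inr j) m = 0).card : ℝ) ≤
        (ℓ : ℝ) + d - k - 1 := by
    intro γ hγ
    have hw := aux_weight (Sum.elim β α) hinj k (fun i => ∑ m, γ m • M i m) (by
      intro f hf
      simp_rw [Finset.sum_mul]
      rw [Finset.sum_comm]
      refine Finset.sum_eq_zero fun m _ => ?_
      have := hC1 f hf m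
      simp_rw [smul_mul_assoc]
      rw [← Finset.smul_sum, this, smul_zero]) (Sum.inl ⟨0, hℓ⟩) (by
      intro h0
      apply hγ
      funext m
      refine Fintype.linearIndependent_iff.mp hC2' γ ?_ m
      simp_rw [← mul_smul_comm]
      rw [← Finset.mul_sum, h0, mul_zero])
    have hsum := Finset.card_filter_add_card_filter_not (s := (univ : Finset (Fin ℓ ⊕ Fin d)))
      (fun i => ∑ m, γ m • M i m = 0)
    have hz : (univ.filter fun j : Fin d => ∑ m, γ m • M (Sum.inr j) m = 0).card ≤
        (univ.filter fun i : Fin ℓ ⊕ Fin d => ∑ m, γ m • M i m = 0).card := by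
      refine Finset.card_le_card_of_injOn Sum.inr ?_ Sum.inr_injective.injOn
      intro j hj
      simpa using hj
    simp only [Finset.card_univ, Fintype.card_sum, Fintype.card_fin] at hsum
    have : (univ.filter fun j : Fin d => ∑ m, γ m • M (Sum.inr j) m = 0).card + k + 1 ≤ ℓ + d := by
      simp only [ne_eq] at hw
      omega
    have h' : ((univ.filter fun j : Fin d => ∑ m, γ m • M (Sum.inr j) m = 0).card : ℝ) + k + 1
      ≤ ℓ + d := by exact_mod_cast this
    linarith
  have hdc : ∑ j : Fin d, ((univ.filter fun γ : Fin t → B =>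
        ∑ m, γ m • M (Sum.inr j) m = 0).card : ℝ) =
      ∑ γ : Fin t → B, ((univ.filter fun j : Fin d =>
        ∑ m, γ m • M (Sum.inr j) m = 0).card : ℝ) := by
    simp_rw [Finset.card_filter]
    push_cast
    exact Finset.sum_comm
  rw [hdc, ← Finset.add_sum_erase _ _ (Finset.mem_univ (0 : Fin t → B)), add_comm]
  refine add_le_add ?_ (by simp)
  refine (Finset.sum_le_card_nsmul _ _ _ fun γ hγ => key γ (Finset.ne_of_mem_erase hγ)).trans ?_
  rw [Finset.card_erase_of_mem (Finset.mem_univ _), nsmul_eq_mul, Finset.card_univ,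
    Nat.cast_sub Fintype.card_pos]
  simp [hcF']
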